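/- Let P : [0,∞) → ℝ be C¹, h C¹ on (0,∞) with h'(r) = P'(r)/r, g(ρ) = ∫₀^ρ h(r) dr. Let (ρ, u) be a classical solution of the 1D QHD system on [0,1]×[0,T] with ρ_x(0,t) = ρ_x(1,t) = 0, u(0,t) = u₀ and u(1,t) = u₁ for all t ∈ [0,T] (u₀, u₁ constants), and suppose K(0,t) = K(1,t) for all t ∈ [0,T], where K(x,t) = ½u² + h(ρ) − (√ρ)_xx/√ρ. Then with E(t) = ∫₀¹ [½ρu² + g(ρ) + ((√ρ)_x)²](x,t) dx, for every t ∈ [0,T]: E(t) ≥ E(0) − max(|u₀|,|u₁|) · ∫₀ᵗ |K(0,s)| (ρ(0,s) + ρ(1,s)) ds. -/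

import Mathlib

open MeasureTheory Real Set

/-- Partial derivative in the first (space) variable. -/
noncomputable def pdx (f : ℝ → ℝ → ℝ) (x t : ℝ) : ℝ := deriv (fun y => f y t) x

/-- Partial derivative in the second (time) variable. -/
noncomputable def pdt (f : ℝ → ℝ → ℝ) (x t : ℝ) : ℝ := deriv (fun s => f x s) t

/-- Pointwise square root of a function of `(x, t)`. -/
noncomputable def sqf (ρ : ℝ → ℝ → ℝ) (x t : ℝ) : ℝ := Real.sqrt (ρ x t)

/-- A classical solution of the one-dimensional quantum hydrodynamic system (with ε² = 2)
`ρ_t + (ρu)_x = 0`, `(ρu)_t + (ρu² + P(ρ))_x = ρ·((√ρ)_xx/√ρ)_x` on `[0,1] × [0,T]`: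
`ρ > 0`, `ρ` of class `C¹` in `t` and `C³` in `x`, `u` of class `C¹` in `t` and `C²` in `x`,
all derivatives jointly continuous, and both equations hold pointwise. -/
structure IsQHDSolution1D (P : ℝ → ℝ) (ρ u : ℝ → ℝ → ℝ) (T : ℝ) : Prop where
  pos : ∀ x ∈ Set.Icc (0:ℝ) 1, ∀ t ∈ Set.Icc (0:ℝ) T, 0 < ρ x t
  rho_C3_x : ∀ t ∈ Set.Icc (0:ℝ) T, ContDiff ℝ 3 (fun x => ρ x t)
  rho_C1_t : ∀ x ∈ Set.Icc (0:ℝ) 1, ContDiff ℝ 1 (fun t => ρ x t)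
  u_C2_x : ∀ t ∈ Set.Icc (0:ℝ) T, ContDiff ℝ 2 (fun x => u x t)
  u_C1_t : ∀ x ∈ Set.Icc (0:ℝ) 1, ContDiff ℝ 1 (fun t => u x t)
  rho_cont : Continuous fun p : ℝ × ℝ => ρ p.1 p.2
  u_cont : Continuous fun p : ℝ × ℝ => u p.1 p.2
  rho_t_cont : Continuous fun p : ℝ × ℝ => pdt ρ p.1 p.2
  rho_x_cont : Continuous fun p : ℝ × ℝ => pdx ρ p.1 p.2
  rho_xx_cont : Continuous fun p : ℝ × ℝ => pdx (pdx ρ) p.1 p.2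
  rho_xxx_cont : Continuous fun p : ℝ × ℝ => pdx (pdx (pdx ρ)) p.1 p.2
  u_t_cont : Continuous fun p : ℝ × ℝ => pdt u p.1 p.2
  u_x_cont : Continuous fun p : ℝ × ℝ => pdx u p.1 p.2
  u_xx_cont : Continuous fun p : ℝ × ℝ => pdx (pdx u) p.1 p.2
  mass : ∀ x ∈ Set.Icc (0:ℝ) 1, ∀ t ∈ Set.Icc (0:ℝ) T,
    pdt ρ x t + pdx (fun y s => ρ y s * u y s) x t = 0
  momentum : ∀ x ∈ Set.Icc (0:ℝ) 1, ∀ t ∈ Set.Icc (0:ℝ) T,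
    pdt (fun y s => ρ y s * u y s) x t
      + pdx (fun y s => ρ y s * u y s ^ 2 + P (ρ y s)) x t
      = ρ x t * pdx (fun y s => pdx (pdx (sqf ρ)) y s / sqf ρ y s) x t

/-- An enthalpy with `h' = P' / r` and `P` of class `C¹` up to `0` has at most a logarithmic
singularity at `0`, hence is integrable there. -/
lemma intervalIntegrable_enthalpy {P h : ℝ → ℝ} (hP : ContDiffOn ℝ 1 P (Ici 0))
    (hh : ContDiffOn ℝ 1 h (Ioi 0)) (hh' : ∀ r > (0 : ℝ), deriv h r = deriv P r / r)
    {r : ℝ} (hr : 0 < r) : IntervalIntegrable h volume 0 r := by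
  have hcont : ContinuousOn h (Ioi 0) := hh.continuousOn
  have hdiff : ∀ x > (0 : ℝ), HasDerivAt h (deriv P x / x) x := fun x hx => by
    rw [← hh' x hx]
    exact ((hh.contDiffAt (Ioi_mem_nhds hx)).differentiableAt (by simp)).hasDerivAt
  obtain ⟨C, hC⟩ := isCompact_Icc.exists_bound_of_continuousOn
    ((hP.continuousOn_derivWithin (uniqueDiffOn_Ici 0) le_rfl).mono
      (Icc_subset_Ici_self : Icc (0 : ℝ) 1 ⊆ Ici 0))
  have hPC : ∀ x ∈ Ioo (0 : ℝ) 1, |deriv P x| ≤ C := fun x hx => by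
    have := hC x ⟨hx.1.le, hx.2.le⟩
    rwa [derivWithin_of_mem_nhds (Ici_mem_nhds hx.1)] at this
  have hlog : ContinuousOn (fun x => C * Real.log x) (Ioc 0 1) :=
    continuousOn_const.mul (Real.continuousOn_log.mono fun x hx => hx.1.ne')
  have hlog' : ∀ x > (0 : ℝ), HasDerivAt (fun x => C * Real.log x) (C / x) x := fun x hx => by
    simpa [div_eq_mul_inv] using (Real.hasDerivAt_log hx.ne').const_mul C
  have hcont' : ContinuousOn h (Ioc 0 1) := hcont.mono fun x hx => hx.1
  have hmono : MonotoneOn (fun x => h x + C * Real.log x) (Ioc 0 1) := by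
    refine monotoneOn_of_deriv_nonneg (convex_Ioc 0 1) (hcont'.add hlog) ?_ ?_ <;>
      rw [interior_Ioc] <;> intro x hx
    · exact ((hdiff x hx.1).fun_add (hlog' x hx.1)).differentiableAt.differentiableWithinAt
    · rw [((hdiff x hx.1).fun_add (hlog' x hx.1)).deriv, ← add_div]
      exact div_nonneg (by linarith [(abs_le.1 (hPC x hx)).1]) hx.1.le
  have hanti : AntitoneOn (fun x => h x - C * Real.log x) (Ioc 0 1) := by
    refine antitoneOn_of_deriv_nonpos (convex_Ioc 0 1) (hcont'.sub hlog) ?_ ?_ <;>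
      rw [interior_Ioc] <;> intro x hx
    · exact ((hdiff x hx.1).fun_sub (hlog' x hx.1)).differentiableAt.differentiableWithinAt
    · rw [((hdiff x hx.1).fun_sub (hlog' x hx.1)).deriv, ← sub_div]
      exact div_nonpos_of_nonpos_of_nonneg (by linarith [(abs_le.1 (hPC x hx)).2]) hx.1.le
  have hint : IntervalIntegrable h volume 0 1 := by
    rw [intervalIntegrable_iff_integrableOn_Ioc_of_le zero_le_one]
    have hb : IntegrableOn (fun x => |h 1| - C * Real.log x) (Ioc 0 1) :=
      (intervalIntegrable_iff_integrableOn_Ioc_of_le zero_le_one).1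
        (intervalIntegrable_const.sub (intervalIntegral.intervalIntegrable_log'.const_mul C))
    refine Integrable.mono' hb (hcont'.aestronglyMeasurable measurableSet_Ioc) ?_
    refine (ae_restrict_iff' measurableSet_Ioc).2 (Filter.Eventually.of_forall fun x hx => ?_)
    have h1 := hmono hx ⟨one_pos, le_rfl⟩ hx.2
    have h2 := hanti hx ⟨one_pos, le_rfl⟩ hx.2
    simp only [Real.log_one, mul_zero, add_zero, sub_zero] at h1 h2
    rw [Real.norm_eq_abs, abs_le]
    constructor <;> linarith [neg_abs_le (h 1), le_abs_self (h 1)]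
  exact hint.trans (hcont.mono fun x hx =>
    lt_of_lt_of_le (lt_min one_pos hr) hx.1).intervalIntegrable

/-- The antiderivative from `0` of the enthalpy has derivative `h` on `(0, ∞)`. -/
lemma hasDerivAt_integral_enthalpy {P h : ℝ → ℝ} (hP : ContDiffOn ℝ 1 P (Ici 0))
    (hh : ContDiffOn ℝ 1 h (Ioi 0)) (hh' : ∀ r > (0 : ℝ), deriv h r = deriv P r / r)
    {r : ℝ} (hr : 0 < r) : HasDerivAt (fun r => ∫ s in (0 : ℝ)..r, h s) (h r) r :=
  intervalIntegral.integral_hasDerivAt_right (intervalIntegrable_enthalpy hP hh hh' hr)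
    (hh.continuousOn.stronglyMeasurableAtFilter isOpen_Ioi r hr)
    (hh.continuousOn.continuousAt (Ioi_mem_nhds hr))

/-- Differentiation at `s = t` of `∫ (B(x,s) - B(x,t)) c(x,s) dx`; no differentiability of `c`
is needed because the first factor vanishes at `s = t`. -/
lemma hasDerivWithinAt_integral_sub_mul {B b c : ℝ → ℝ → ℝ} {T t : ℝ} (ht : t ∈ Icc 0 T)
    (hB : ∀ x ∈ Icc (0 : ℝ) 1, ∀ s ∈ Icc 0 T, HasDerivWithinAt (B x) (b x s) (Icc 0 T) s)
    (hBc : ∀ s ∈ Icc 0 T, ContinuousOn (fun x => B x s) (Icc 0 1))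
    (hb : ContinuousOn (fun p : ℝ × ℝ => b p.1 p.2) (Icc 0 1 ×ˢ Icc 0 T))
    (hc : ContinuousOn (fun p : ℝ × ℝ => c p.1 p.2) (Icc 0 1 ×ˢ Icc 0 T)) :
    HasDerivWithinAt (fun s => ∫ x in (0 : ℝ)..1, (B x s - B x t) * c x s)
      (∫ x in (0 : ℝ)..1, b x t * c x t) (Icc 0 T) t := by
  obtain ⟨M, hM⟩ := (isCompact_Icc.prod isCompact_Icc).exists_bound_of_continuousOn hb
  obtain ⟨N, hN⟩ := (isCompact_Icc.prod isCompact_Icc).exists_bound_of_continuousOn hc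
  have hIoc : ∀ x : ℝ, x ∈ uIoc (0 : ℝ) 1 → x ∈ Icc (0 : ℝ) 1 := fun x hx => by
    rw [uIoc_of_le zero_le_one] at hx
    exact Ioc_subset_Icc_self hx
  have hev : ∀ᶠ s in nhdsWithin t (Icc 0 T \ {t}), s ∈ Icc 0 T \ {t} := self_mem_nhdsWithin
  rw [hasDerivWithinAt_iff_tendsto_slope]
  have hslope : ∀ s, slope (fun s => ∫ x in (0 : ℝ)..1, (B x s - B x t) * c x s) t s
      = ∫ x in (0 : ℝ)..1, slope (B x) t s * c x s := fun s => by
    simp only [slope_def_field, sub_self, zero_mul, intervalIntegral.integral_zero, sub_zero]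
    rw [div_eq_inv_mul, ← intervalIntegral.integral_const_mul]
    congr 1
    ext x
    ring
  simp only [funext hslope]
  refine intervalIntegral.tendsto_integral_filter_of_dominated_convergence (fun _ => M * N)
    ?_ ?_ intervalIntegrable_const ?_
  · filter_upwards [hev] with s hs
    have h1 : ContinuousOn (fun x => slope (B x) t s) (Icc 0 1) := by
      simp only [slope_def_field]
      exact ((hBc s hs.1).sub (hBc t ht)).div_const _
    have h2 : ContinuousOn (fun x => c x s) (Icc 0 1) :=
      hc.comp (f := fun x => (x, s)) (by fun_prop) fun x hx => ⟨hx, hs.1⟩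
    rw [uIoc_of_le zero_le_one]
    exact ((h1.mul h2).mono Ioc_subset_Icc_self).aestronglyMeasurable measurableSet_Ioc
  · filter_upwards [hev] with s hs
    refine Filter.Eventually.of_forall fun x hx => ?_
    have hx' := hIoc x hx
    have hne : 0 < |s - t| := abs_pos.2 (sub_ne_zero.2 hs.2)
    have hmv : ‖B x s - B x t‖ ≤ M * ‖s - t‖ :=
      (convex_Icc 0 T).norm_image_sub_le_of_norm_hasDerivWithin_le
        (fun y hy => hB x hx' y hy) (fun y hy => hM (x, y) ⟨hx', hy⟩) ht hs.1
    rw [norm_mul]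
    refine mul_le_mul ?_ (hN (x, s) ⟨hx', hs.1⟩) (norm_nonneg _)
      ((norm_nonneg _).trans (hM (x, s) ⟨hx', hs.1⟩))
    rw [slope_def_field, norm_div, Real.norm_eq_abs (s - t), div_le_iff₀ hne]
    exact hmv
  · refine Filter.Eventually.of_forall fun x hx => ?_
    have hx' := hIoc x hx
    refine ((hasDerivWithinAt_iff_tendsto_slope.1 (hB x hx' t ht))).mul ?_
    have h2 : ContinuousOn (fun s => c x s) (Icc 0 T) :=
      hc.comp (f := fun s => (x, s)) (by fun_prop) fun s hs => ⟨hx', hs⟩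
    exact (h2 t ht).mono_left (nhdsWithin_mono _ sdiff_subset)

/-- Second derivative of the square root of a positive function. -/
lemma hasDerivAt_deriv_sqrt {f f₁ : ℝ → ℝ} {f₂ x : ℝ} (hf : ∀ y, HasDerivAt f (f₁ y) y)
    (hf₁ : HasDerivAt f₁ f₂ x) (hx : 0 < f x) :
    HasDerivAt (deriv fun y => √(f y)) (f₂ / (2 * √(f x)) - f₁ x ^ 2 / (4 * f x * √(f x))) x := by
  have hev : (deriv fun y => √(f y)) =ᶠ[nhds x] fun y => f₁ y / (2 * √(f y)) := by
    filter_upwards [(hf x).continuousAt.eventually (lt_mem_nhds hx)] with y hy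
    exact ((hf y).sqrt (ne_of_gt hy)).deriv
  have hs : 0 < √(f x) := Real.sqrt_pos.2 hx
  refine HasDerivAt.congr_of_eventuallyEq ?_ hev
  refine (hf₁.fun_div (((hf x).sqrt hx.ne').const_mul 2) (by positivity)).congr_deriv ?_
  have h2 : √(f x) ^ 2 = f x := Real.sq_sqrt hx.le
  rw [← h2, Real.sqrt_sq hs.le]
  field_simp
  ring

namespace IsQHDSolution1D

variable {P : ℝ → ℝ} {ρ u : ℝ → ℝ → ℝ} {T : ℝ}

lemma contDiff_pdx_rho (hsol : IsQHDSolution1D P ρ u T) {t : ℝ} (ht : t ∈ Icc 0 T) :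
    ContDiff ℝ 2 fun x => pdx ρ x t :=
  (contDiff_succ_iff_deriv (n := 2).1 (hsol.rho_C3_x t ht)).2.2

lemma contDiff_pdx_pdx_rho (hsol : IsQHDSolution1D P ρ u T) {t : ℝ} (ht : t ∈ Icc 0 T) :
    ContDiff ℝ 1 fun x => pdx (pdx ρ) x t :=
  (contDiff_succ_iff_deriv (n := 1).1 (hsol.contDiff_pdx_rho ht)).2.2

lemma hasDerivAt_rho (hsol : IsQHDSolution1D P ρ u T) {t : ℝ} (ht : t ∈ Icc 0 T) (x : ℝ) :
    HasDerivAt (fun y => ρ y t) (pdx ρ x t) x :=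
  ((hsol.rho_C3_x t ht).differentiable (by simp) x).hasDerivAt

lemma hasDerivAt_pdx_rho (hsol : IsQHDSolution1D P ρ u T) {t : ℝ} (ht : t ∈ Icc 0 T) (x : ℝ) :
    HasDerivAt (fun y => pdx ρ y t) (pdx (pdx ρ) x t) x :=
  ((hsol.contDiff_pdx_rho ht).differentiable (by simp) x).hasDerivAt

lemma hasDerivAt_pdx_pdx_rho (hsol : IsQHDSolution1D P ρ u T) {t : ℝ} (ht : t ∈ Icc 0 T)
    (x : ℝ) : HasDerivAt (fun y => pdx (pdx ρ) y t) (pdx (pdx (pdx ρ)) x t) x :=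
  ((hsol.contDiff_pdx_pdx_rho ht).differentiable (by simp) x).hasDerivAt

lemma hasDerivAt_u (hsol : IsQHDSolution1D P ρ u T) {t : ℝ} (ht : t ∈ Icc 0 T) (x : ℝ) :
    HasDerivAt (fun y => u y t) (pdx u x t) x :=
  ((hsol.u_C2_x t ht).differentiable (by simp) x).hasDerivAt

lemma hasDerivAt_rho_time (hsol : IsQHDSolution1D P ρ u T) {x : ℝ} (hx : x ∈ Icc (0 : ℝ) 1)
    (t : ℝ) : HasDerivAt (ρ x) (pdt ρ x t) t :=
  ((hsol.rho_C1_t x hx).differentiable (by simp) t).hasDerivAt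

lemma hasDerivAt_u_time (hsol : IsQHDSolution1D P ρ u T) {x : ℝ} (hx : x ∈ Icc (0 : ℝ) 1)
    (t : ℝ) : HasDerivAt (u x) (pdt u x t) t :=
  ((hsol.u_C1_t x hx).differentiable (by simp) t).hasDerivAt

lemma sqf_pos (hsol : IsQHDSolution1D P ρ u T) {x t : ℝ} (hx : x ∈ Icc (0 : ℝ) 1)
    (ht : t ∈ Icc 0 T) : 0 < sqf ρ x t :=
  Real.sqrt_pos.2 (hsol.pos x hx t ht)

lemma hasDerivAt_sqf (hsol : IsQHDSolution1D P ρ u T) {x t : ℝ} (ht : t ∈ Icc 0 T)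
    (hρ : 0 < ρ x t) : HasDerivAt (fun y => sqf ρ y t) (pdx ρ x t / (2 * sqf ρ x t)) x :=
  (hsol.hasDerivAt_rho ht x).sqrt hρ.ne'

lemma pdx_sqf (hsol : IsQHDSolution1D P ρ u T) {x t : ℝ} (ht : t ∈ Icc 0 T)
    (hρ : 0 < ρ x t) : pdx (sqf ρ) x t = pdx ρ x t / (2 * sqf ρ x t) :=
  (hsol.hasDerivAt_sqf ht hρ).deriv

lemma hasDerivAt_pdx_sqf (hsol : IsQHDSolution1D P ρ u T) {x t : ℝ} (ht : t ∈ Icc 0 T)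
    (hρ : 0 < ρ x t) : HasDerivAt (fun y => pdx (sqf ρ) y t)
      (pdx (pdx ρ) x t / (2 * sqf ρ x t) - pdx ρ x t ^ 2 / (4 * ρ x t * sqf ρ x t)) x :=
  hasDerivAt_deriv_sqrt (hsol.hasDerivAt_rho ht) (hsol.hasDerivAt_pdx_rho ht x) hρ

lemma pdx_pdx_sqf (hsol : IsQHDSolution1D P ρ u T) {x t : ℝ} (ht : t ∈ Icc 0 T)
    (hρ : 0 < ρ x t) : pdx (pdx (sqf ρ)) x t =
      pdx (pdx ρ) x t / (2 * sqf ρ x t) - pdx ρ x t ^ 2 / (4 * ρ x t * sqf ρ x t) :=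
  (hsol.hasDerivAt_pdx_sqf ht hρ).deriv

lemma continuous_sqf (hsol : IsQHDSolution1D P ρ u T) :
    Continuous fun p : ℝ × ℝ => sqf ρ p.1 p.2 :=
  Real.continuous_sqrt.comp hsol.rho_cont

lemma continuousOn_pdx_sqf (hsol : IsQHDSolution1D P ρ u T) :
    ContinuousOn (fun p : ℝ × ℝ => pdx (sqf ρ) p.1 p.2) (Icc 0 1 ×ˢ Icc 0 T) := by
  refine ContinuousOn.congr (f := fun p : ℝ × ℝ => pdx ρ p.1 p.2 / (2 * sqf ρ p.1 p.2)) ?_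
    fun p hp => hsol.pdx_sqf hp.2 (hsol.pos _ hp.1 _ hp.2)
  refine hsol.rho_x_cont.continuousOn.div
    (continuous_const.mul hsol.continuous_sqf).continuousOn fun p hp => ?_
  have := hsol.sqf_pos hp.1 hp.2
  positivity

lemma continuousOn_pdx_pdx_sqf (hsol : IsQHDSolution1D P ρ u T) :
    ContinuousOn (fun p : ℝ × ℝ => pdx (pdx (sqf ρ)) p.1 p.2) (Icc 0 1 ×ˢ Icc 0 T) := by
  refine ContinuousOn.congr (f := fun p : ℝ × ℝ => pdx (pdx ρ) p.1 p.2 / (2 * sqf ρ p.1 p.2)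
      - pdx ρ p.1 p.2 ^ 2 / (4 * ρ p.1 p.2 * sqf ρ p.1 p.2)) ?_
    fun p hp => hsol.pdx_pdx_sqf hp.2 (hsol.pos _ hp.1 _ hp.2)
  have hs : ∀ p ∈ Icc (0 : ℝ) 1 ×ˢ Icc 0 T, sqf ρ p.1 p.2 ≠ 0 :=
    fun p hp => (hsol.sqf_pos hp.1 hp.2).ne'
  have hρ : ∀ p ∈ Icc (0 : ℝ) 1 ×ˢ Icc 0 T, ρ p.1 p.2 ≠ 0 :=
    fun p hp => (hsol.pos _ hp.1 _ hp.2).ne'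
  exact (hsol.rho_xx_cont.continuousOn.div
    (continuous_const.mul hsol.continuous_sqf).continuousOn
      fun p hp => mul_ne_zero two_ne_zero (hs p hp)).sub
    ((hsol.rho_x_cont.pow 2).continuousOn.div
      ((continuous_const.mul hsol.rho_cont).mul hsol.continuous_sqf).continuousOn
      fun p hp => mul_ne_zero (mul_ne_zero four_ne_zero (hρ p hp)) (hs p hp))

lemma differentiableAt_bohm (hsol : IsQHDSolution1D P ρ u T) {x t : ℝ} (ht : t ∈ Icc 0 T)
    (hρ : 0 < ρ x t) :
    DifferentiableAt ℝ (fun y => pdx (pdx (sqf ρ)) y t / sqf ρ y t) x := by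
  have hs : 0 < sqf ρ x t := Real.sqrt_pos.2 hρ
  have hev : (fun y => pdx (pdx (sqf ρ)) y t) =ᶠ[nhds x] fun y =>
      pdx (pdx ρ) y t / (2 * sqf ρ y t) - pdx ρ y t ^ 2 / (4 * ρ y t * sqf ρ y t) := by
    filter_upwards [(hsol.hasDerivAt_rho ht x).continuousAt.eventually (lt_mem_nhds hρ)] with y hy
    exact hsol.pdx_pdx_sqf ht hy
  have d0 := (hsol.hasDerivAt_rho ht x).differentiableAt
  have d1 := (hsol.hasDerivAt_pdx_rho ht x).differentiableAt
  have d2 := (hsol.hasDerivAt_pdx_pdx_rho ht x).differentiableAt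
  have ds := (hsol.hasDerivAt_sqf ht hρ).differentiableAt
  refine DifferentiableAt.fun_div (DifferentiableAt.congr_of_eventuallyEq ?_ hev) ds hs.ne'
  have hn2 : 2 * sqf ρ x t ≠ 0 := by positivity
  have hn4 : 4 * ρ x t * sqf ρ x t ≠ 0 := by positivity
  exact (d2.fun_div (ds.const_mul 2) hn2).fun_sub
    ((d1.fun_pow 2).fun_div ((d0.const_mul 4).fun_mul ds) hn4)

/-- Local energy balance: the time derivative of the energy density (up to the term integrated
by parts) is minus the space derivative of the flux `ρ u K`. -/
lemma hasDerivAt_flux (hsol : IsQHDSolution1D P ρ u T) {h : ℝ → ℝ}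
    (hP : ContDiffOn ℝ 1 P (Ici 0)) (hh : ContDiffOn ℝ 1 h (Ioi 0))
    (hh' : ∀ r > (0 : ℝ), deriv h r = deriv P r / r) {K : ℝ → ℝ → ℝ}
    (hK : ∀ x t : ℝ, K x t = u x t ^ 2 / 2 + h (ρ x t) - pdx (pdx (sqf ρ)) x t / sqf ρ x t)
    {x t : ℝ} (hx : x ∈ Icc (0 : ℝ) 1) (ht : t ∈ Icc 0 T) :
    HasDerivAt (fun y => ρ y t * u y t * K y t)
      (-(pdt ρ x t * u x t ^ 2 / 2 + ρ x t * u x t * pdt u x t + h (ρ x t) * pdt ρ x t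
        - pdt ρ x t * (pdx (pdx (sqf ρ)) x t / sqf ρ x t))) x := by
  have hρ := hsol.pos x hx t ht
  have dr := hsol.hasDerivAt_rho ht x
  have du := hsol.hasDerivAt_u ht x
  have drt := hsol.hasDerivAt_rho_time hx t
  have dut := hsol.hasDerivAt_u_time hx t
  have dP : HasDerivAt P (deriv P (ρ x t)) (ρ x t) :=
    ((hP.contDiffAt (Ici_mem_nhds hρ)).differentiableAt (by simp)).hasDerivAt
  have dh : HasDerivAt h (deriv P (ρ x t) / ρ x t) (ρ x t) := by
    rw [← hh' _ hρ]
    exact ((hh.contDiffAt (Ioi_mem_nhds hρ)).differentiableAt (by simp)).hasDerivAt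
  have dq := (hsol.differentiableAt_bohm ht hρ).hasDerivAt
  have hmass := hsol.mass x hx t ht
  have hmom := hsol.momentum x hx t ht
  have e1 : pdx (fun y s => ρ y s * u y s) x t = _ := (dr.fun_mul du).deriv
  have e2 : pdt (fun y s => ρ y s * u y s) x t = _ := (drt.fun_mul dut).deriv
  have e3 : pdx (fun y s => ρ y s * u y s ^ 2 + P (ρ y s)) x t = _ :=
    ((dr.fun_mul (du.fun_pow 2)).fun_add (dP.comp x dr)).deriv
  have e4 : pdx (fun y s => pdx (pdx (sqf ρ)) y s / sqf ρ y s) x t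
      = deriv (fun y => pdx (pdx (sqf ρ)) y t / sqf ρ y t) x := rfl
  rw [e1] at hmass
  rw [e2, e3, e4] at hmom
  simp only [hK]
  refine ((dr.fun_mul du).fun_mul
    ((((du.fun_pow 2).div_const 2).fun_add (dh.comp x dr)).fun_sub dq)).congr_deriv ?_
  generalize deriv (fun y => pdx (pdx (sqf ρ)) y t / sqf ρ y t) x = qx at *
  generalize pdx (pdx (sqf ρ)) x t / sqf ρ x t = q at *
  norm_num at hmom ⊢
  have hr : ρ x t * (deriv P (ρ x t) / ρ x t) = deriv P (ρ x t) := by field_simp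
  linear_combination hmass * (u x t ^ 2 / 2 + h (ρ x t) - q) + u x t * (hmom - u x t * hmass)
    + hr * u x t * pdx ρ x t

/-- Differentiation of the energy in time, the quantum term being integrated by parts in space
before the limit so that no mixed derivative of `ρ` is needed. -/
lemma hasDerivWithinAt_energy (hsol : IsQHDSolution1D P ρ u T) {h g : ℝ → ℝ}
    (hh : ContinuousOn h (Ioi 0)) (hg : ∀ r > (0 : ℝ), HasDerivAt g (h r) r)
    (hNeumann : ∀ t ∈ Icc (0 : ℝ) T, pdx ρ 0 t = 0 ∧ pdx ρ 1 t = 0) {E : ℝ → ℝ}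
    (hE : ∀ t : ℝ, E t = ∫ x in (0:ℝ)..1,
      (ρ x t * u x t ^ 2 / 2 + g (ρ x t) + (pdx (sqf ρ) x t) ^ 2))
    {t : ℝ} (ht : t ∈ Icc 0 T) :
    HasDerivWithinAt E (∫ x in (0:ℝ)..1, (pdt ρ x t * u x t ^ 2 / 2 + ρ x t * u x t * pdt u x t
      + h (ρ x t) * pdt ρ x t - pdt ρ x t * (pdx (pdx (sqf ρ)) x t / sqf ρ x t)))
      (Icc 0 T) t := by
  have hgc : ContinuousOn g (Ioi 0) := fun r hr => (hg r hr).continuousAt.continuousWithinAt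
  have hmaps : MapsTo (fun p : ℝ × ℝ => ρ p.1 p.2) (Icc 0 1 ×ˢ Icc 0 T) (Ioi 0) :=
    fun p hp => hsol.pos _ hp.1 _ hp.2
  have hslice : ∀ {f : ℝ → ℝ → ℝ} {s : ℝ}, s ∈ Icc 0 T →
      ContinuousOn (fun p : ℝ × ℝ => f p.1 p.2) (Icc 0 1 ×ˢ Icc 0 T) →
      ContinuousOn (fun x => f x s) (Icc 0 1) := fun {f s} hs hf =>
    hf.comp (f := fun x => (x, s)) (by fun_prop) fun x hx => ⟨hx, hs⟩
  have hii : ∀ {f : ℝ → ℝ}, ContinuousOn f (Icc 0 1) → IntervalIntegrable f volume 0 1 :=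
    fun hf => hf.intervalIntegrable_of_Icc zero_le_one
  have hA : ContinuousOn (fun p : ℝ × ℝ => ρ p.1 p.2 * u p.1 p.2 ^ 2 / 2 + g (ρ p.1 p.2))
      (Icc 0 1 ×ˢ Icc 0 T) :=
    ((hsol.rho_cont.mul (hsol.u_cont.pow 2)).div_const 2).continuousOn.add
      (hgc.comp hsol.rho_cont.continuousOn hmaps)
  have ha : ContinuousOn (fun p : ℝ × ℝ => pdt ρ p.1 p.2 * u p.1 p.2 ^ 2 / 2
      + ρ p.1 p.2 * u p.1 p.2 * pdt u p.1 p.2 + h (ρ p.1 p.2) * pdt ρ p.1 p.2)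
      (Icc 0 1 ×ˢ Icc 0 T) :=
    (((hsol.rho_t_cont.mul (hsol.u_cont.pow 2)).div_const 2).add
      ((hsol.rho_cont.mul hsol.u_cont).mul hsol.u_t_cont)).continuousOn.add
      ((hh.comp hsol.rho_cont.continuousOn hmaps).mul hsol.rho_t_cont.continuousOn)
  have hw : ContinuousOn (fun p : ℝ × ℝ => pdt ρ p.1 p.2 / (2 * sqf ρ p.1 p.2))
      (Icc 0 1 ×ˢ Icc 0 T) :=
    hsol.rho_t_cont.continuousOn.div (continuous_const.mul hsol.continuous_sqf).continuousOn
      fun p hp => by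
        have := hsol.sqf_pos hp.1 hp.2
        positivity
  have hwx := hsol.continuousOn_pdx_sqf
  have hwxx := hsol.continuousOn_pdx_pdx_sqf
  have hc : ContinuousOn
      (fun p : ℝ × ℝ => -(pdx (pdx (sqf ρ)) p.1 p.2 + pdx (pdx (sqf ρ)) p.1 t))
      (Icc 0 1 ×ˢ Icc 0 T) :=
    (hwxx.add ((hslice ht hwxx).comp continuous_fst.continuousOn fun p hp => hp.1)).neg
  have hparts : ∀ s ∈ Icc 0 T,
      ∫ x in (0:ℝ)..1, (sqf ρ x s - sqf ρ x t) * -(pdx (pdx (sqf ρ)) x s + pdx (pdx (sqf ρ)) x t)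
        = ∫ x in (0:ℝ)..1, (pdx (sqf ρ) x s ^ 2 - pdx (sqf ρ) x t ^ 2) := fun s hs => by
    have hd : ∀ x ∈ uIcc (0 : ℝ) 1, HasDerivAt
        (fun y => (sqf ρ y s - sqf ρ y t) * (pdx (sqf ρ) y s + pdx (sqf ρ) y t))
        ((pdx (sqf ρ) x s ^ 2 - pdx (sqf ρ) x t ^ 2)
          - (sqf ρ x s - sqf ρ x t) * -(pdx (pdx (sqf ρ)) x s + pdx (pdx (sqf ρ)) x t)) x := by
      intro x hx
      rw [uIcc_of_le zero_le_one] at hx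
      have d1 : ∀ {r}, r ∈ Icc 0 T → HasDerivAt (fun y => sqf ρ y r) (pdx (sqf ρ) x r) x :=
        fun hr => (hsol.hasDerivAt_sqf hr (hsol.pos x hx _ hr)).differentiableAt.hasDerivAt
      have d2 : ∀ {r}, r ∈ Icc 0 T →
          HasDerivAt (fun y => pdx (sqf ρ) y r) (pdx (pdx (sqf ρ)) x r) x :=
        fun hr => (hsol.hasDerivAt_pdx_sqf hr (hsol.pos x hx _ hr)).differentiableAt.hasDerivAt
      refine (((d1 hs).fun_sub (d1 ht)).fun_mul ((d2 hs).fun_add (d2 ht))).congr_deriv ?_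
      ring
    have i1 : IntervalIntegrable (fun x => pdx (sqf ρ) x s ^ 2 - pdx (sqf ρ) x t ^ 2) volume 0 1 :=
      hii (((hslice hs hwx).pow 2).sub ((hslice ht hwx).pow 2))
    have i2 : IntervalIntegrable (fun x => (sqf ρ x s - sqf ρ x t) *
        -(pdx (pdx (sqf ρ)) x s + pdx (pdx (sqf ρ)) x t)) volume 0 1 :=
      hii (((hslice hs hsol.continuous_sqf.continuousOn).sub
        (hslice ht hsol.continuous_sqf.continuousOn)).mul
        ((hslice hs hwxx).add (hslice ht hwxx)).neg)
    have hftc := intervalIntegral.integral_eq_sub_of_hasDerivAt hd (i1.sub i2)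
    have hbd : ∀ {r}, r ∈ Icc 0 T → pdx (sqf ρ) 0 r = 0 ∧ pdx (sqf ρ) 1 r = 0 := fun {r} hr => by
      rw [hsol.pdx_sqf hr (hsol.pos 0 (by simp) r hr), hsol.pdx_sqf hr (hsol.pos 1 (by simp) r hr),
        (hNeumann r hr).1, (hNeumann r hr).2]
      simp
    rw [intervalIntegral.integral_sub i1 i2, (hbd hs).1, (hbd hs).2, (hbd ht).1, (hbd ht).2] at hftc
    linarith
  have hD1 := hasDerivWithinAt_integral_sub_mul
    (B := fun x s => ρ x s * u x s ^ 2 / 2 + g (ρ x s))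
    (b := fun x s => pdt ρ x s * u x s ^ 2 / 2 + ρ x s * u x s * pdt u x s
      + h (ρ x s) * pdt ρ x s) (c := fun _ _ => 1) ht
    (fun x hx s hs => by
      have dr := hsol.hasDerivAt_rho_time hx s
      have du := hsol.hasDerivAt_u_time hx s
      refine HasDerivAt.hasDerivWithinAt ?_
      refine (((dr.fun_mul (du.fun_pow 2)).div_const 2).fun_add
        ((hg _ (hsol.pos x hx s hs)).comp s dr)).congr_deriv ?_
      norm_num
      ring)
    (fun s hs => hslice (f := fun x s => ρ x s * u x s ^ 2 / 2 + g (ρ x s)) hs hA)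
    ha continuousOn_const
  have hD2 := hasDerivWithinAt_integral_sub_mul (B := sqf ρ)
    (b := fun x s => pdt ρ x s / (2 * sqf ρ x s))
    (c := fun x s => -(pdx (pdx (sqf ρ)) x s + pdx (pdx (sqf ρ)) x t)) ht
    (fun x hx s hs => ((hsol.hasDerivAt_rho_time hx s).sqrt
      (hsol.pos x hx s hs).ne').hasDerivWithinAt)
    (fun s hs => hslice hs hsol.continuous_sqf.continuousOn) hw hc
  have hEq : ∀ s ∈ Icc 0 T, E s = E t +
      ((∫ x in (0:ℝ)..1, (ρ x s * u x s ^ 2 / 2 + g (ρ x s)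
        - (ρ x t * u x t ^ 2 / 2 + g (ρ x t))) * 1)
      + ∫ x in (0:ℝ)..1, (sqf ρ x s - sqf ρ x t) *
        -(pdx (pdx (sqf ρ)) x s + pdx (pdx (sqf ρ)) x t)) := fun s hs => by
    have iA : ∀ {r}, r ∈ Icc 0 T →
        IntervalIntegrable (fun x => ρ x r * u x r ^ 2 / 2 + g (ρ x r)) volume 0 1 :=
      fun hr => hii (hslice (f := fun x s => ρ x s * u x s ^ 2 / 2 + g (ρ x s)) hr hA)
    have iW : ∀ {r}, r ∈ Icc 0 T →
        IntervalIntegrable (fun x => pdx (sqf ρ) x r ^ 2) volume 0 1 :=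
      fun hr => hii ((hslice hr hwx).pow 2)
    simp only [mul_one]
    rw [hparts s hs, hE, hE, intervalIntegral.integral_add (iA hs) (iW hs),
      intervalIntegral.integral_add (iA ht) (iW ht), intervalIntegral.integral_sub (iA hs) (iA ht),
      intervalIntegral.integral_sub (iW hs) (iW ht)]
    ring
  refine (((hD1.fun_add hD2).const_add (E t)).congr hEq (hEq t ht)).congr_deriv ?_
  have i1 : IntervalIntegrable (fun x => (pdt ρ x t * u x t ^ 2 / 2
      + ρ x t * u x t * pdt u x t + h (ρ x t) * pdt ρ x t) * 1) volume 0 1 :=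
    hii ((hslice (f := fun x s => pdt ρ x s * u x s ^ 2 / 2 + ρ x s * u x s * pdt u x s
      + h (ρ x s) * pdt ρ x s) ht ha).mul continuousOn_const)
  have i2 : IntervalIntegrable (fun x => pdt ρ x t / (2 * sqf ρ x t)
      * -(pdx (pdx (sqf ρ)) x t + pdx (pdx (sqf ρ)) x t)) volume 0 1 :=
    hii ((hslice (f := fun x s => pdt ρ x s / (2 * sqf ρ x s)) ht hw).mul
      ((hslice ht hwxx).add (hslice ht hwxx)).neg)
  rw [← intervalIntegral.integral_add i1 i2]
  refine intervalIntegral.integral_congr fun x hx => ?_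
  rw [uIcc_of_le zero_le_one] at hx
  have := hsol.sqf_pos hx ht
  field_simp
  ring

end IsQHDSolution1D

/-- Energy lower bound for the 1D QHD system with Neumann conditions for `ρ` and constant
Dirichlet velocity boundary values, assuming `K(0,t) = K(1,t)`:
`E(t) ≥ E(0) − max(|u₀|,|u₁|) ∫₀ᵗ |K(0,s)| (ρ(0,s) + ρ(1,s)) ds`. -/
theorem qhd1d_energy_lower_bound
    (P h : ℝ → ℝ) (hP : ContDiffOn ℝ 1 P (Set.Ici 0))
    (hh : ContDiffOn ℝ 1 h (Set.Ioi 0))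
    (hh' : ∀ r > (0:ℝ), deriv h r = deriv P r / r)
    (g : ℝ → ℝ) (hg : ∀ r : ℝ, g r = ∫ s in (0:ℝ)..r, h s)
    (T : ℝ) (hT : 0 ≤ T) (ρ u : ℝ → ℝ → ℝ) (u₀ u₁ : ℝ)
    (hsol : IsQHDSolution1D P ρ u T)
    (hNeumann : ∀ t ∈ Set.Icc (0:ℝ) T, pdx ρ 0 t = 0 ∧ pdx ρ 1 t = 0)
    (hDirichlet : ∀ t ∈ Set.Icc (0:ℝ) T, u 0 t = u₀ ∧ u 1 t = u₁)
    (K : ℝ → ℝ → ℝ)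
    (hK : ∀ x t : ℝ, K x t = u x t ^ 2 / 2 + h (ρ x t) - pdx (pdx (sqf ρ)) x t / sqf ρ x t)
    (hKbd : ∀ t ∈ Set.Icc (0:ℝ) T, K 0 t = K 1 t)
    (E : ℝ → ℝ)
    (hE : ∀ t : ℝ, E t = ∫ x in (0:ℝ)..1,
      (ρ x t * u x t ^ 2 / 2 + g (ρ x t) + (pdx (sqf ρ) x t) ^ 2)) :
    ∀ t ∈ Set.Icc (0:ℝ) T,
      E 0 - max |u₀| |u₁| * ∫ s in (0:ℝ)..t, |K 0 s| * (ρ 0 s + ρ 1 s) ≤ E t := by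
  intro t ht
  have hg' : ∀ r > (0 : ℝ), HasDerivAt g (h r) r := fun r hr => by
    rw [funext hg]
    exact hasDerivAt_integral_enthalpy hP hh hh' hr
  have h0 : (0 : ℝ) ∈ Icc (0 : ℝ) 1 := ⟨le_rfl, zero_le_one⟩
  have h1 : (1 : ℝ) ∈ Icc (0 : ℝ) 1 := ⟨zero_le_one, le_rfl⟩
  have hflux : ∀ s ∈ Icc 0 T, HasDerivWithinAt E (-(K 0 s * (ρ 1 s * u₁ - ρ 0 s * u₀)))
      (Icc 0 T) s := fun s hs => by
    refine (hsol.hasDerivWithinAt_energy hh.continuousOn hg' hNeumann hE hs).congr_deriv ?_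
    have hρc : Continuous fun x => ρ x s := (hsol.rho_C3_x s hs).continuous
    have huc : Continuous fun x => u x s := (hsol.u_C2_x s hs).continuous
    have hρt : Continuous fun x => pdt ρ x s :=
      hsol.rho_t_cont.comp (f := fun x => (x, s)) (by fun_prop)
    have hut : Continuous fun x => pdt u x s :=
      hsol.u_t_cont.comp (f := fun x => (x, s)) (by fun_prop)
    have hhc : ContinuousOn (fun x => h (ρ x s)) (Icc 0 1) :=
      hh.continuousOn.comp hρc.continuousOn fun x hx => hsol.pos x hx s hs
    have hq : ContinuousOn (fun x => pdx (pdx (sqf ρ)) x s / sqf ρ x s) (Icc 0 1) := fun x hx =>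
      (hsol.differentiableAt_bohm hs (hsol.pos x hx s hs)).continuousAt.continuousWithinAt
    have hint : IntervalIntegrable (fun x => pdt ρ x s * u x s ^ 2 / 2
        + ρ x s * u x s * pdt u x s + h (ρ x s) * pdt ρ x s
        - pdt ρ x s * (pdx (pdx (sqf ρ)) x s / sqf ρ x s)) volume 0 1 := by
      refine ContinuousOn.intervalIntegrable_of_Icc zero_le_one ?_
      exact (((((hρt.mul (huc.pow 2)).div_const 2).add ((hρc.mul huc).mul hut)).continuousOn).add
        (hhc.mul hρt.continuousOn)).sub (hρt.continuousOn.mul hq)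
    have hftc := intervalIntegral.integral_eq_sub_of_hasDerivAt
      (fun x hx => hsol.hasDerivAt_flux hP hh hh' hK
        (by rwa [uIcc_of_le zero_le_one] at hx) hs) hint.neg
    rw [intervalIntegral.integral_neg, ← hKbd s hs, (hDirichlet s hs).1, (hDirichlet s hs).2]
      at hftc
    linarith
  have hKc : ContinuousOn (K 0) (Icc 0 T) := by
    have hmaps : MapsTo (fun s : ℝ => ((0 : ℝ), s)) (Icc 0 T) (Icc 0 1 ×ˢ Icc 0 T) :=
      fun s hs => ⟨h0, hs⟩
    have hρc : Continuous fun s => ρ 0 s := (hsol.rho_C1_t 0 h0).continuous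
    have huc : Continuous fun s => u 0 s := (hsol.u_C1_t 0 h0).continuous
    have hw : Continuous fun s => sqf ρ 0 s := Real.continuous_sqrt.comp hρc
    have hwxx : ContinuousOn (fun s => pdx (pdx (sqf ρ)) 0 s) (Icc 0 T) :=
      hsol.continuousOn_pdx_pdx_sqf.comp (f := fun s => (0, s)) (by fun_prop) hmaps
    rw [show K 0 = _ from funext (hK 0)]
    exact (((huc.pow 2).div_const 2).continuousOn.add
      (hh.continuousOn.comp hρc.continuousOn fun s hs => hsol.pos 0 h0 s hs)).sub
      (hwxx.div hw.continuousOn fun s hs => (hsol.sqf_pos h0 hs).ne')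
  have hρ0 : Continuous (ρ 0) := (hsol.rho_C1_t 0 h0).continuous
  have hρ1 : Continuous (ρ 1) := (hsol.rho_C1_t 1 h1).continuous
  have hsub : Icc 0 t ⊆ Icc 0 T := Icc_subset_Icc_right ht.2
  have hI1 : IntervalIntegrable (fun s => -(K 0 s * (ρ 1 s * u₁ - ρ 0 s * u₀))) volume 0 t :=
    ((hKc.mono hsub).mul ((hρ1.mul continuous_const).sub
      (hρ0.mul continuous_const)).continuousOn).neg.intervalIntegrable_of_Icc ht.1
  have hI2 : IntervalIntegrable (fun s => |K 0 s| * (ρ 0 s + ρ 1 s)) volume 0 t :=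
    ((hKc.mono hsub).abs.mul (hρ0.add hρ1).continuousOn).intervalIntegrable_of_Icc ht.1
  have hEt : ∫ s in (0 : ℝ)..t, -(K 0 s * (ρ 1 s * u₁ - ρ 0 s * u₀)) = E t - E 0 := by
    refine intervalIntegral.integral_eq_sub_of_hasDerivAt_of_le ht.1
      (fun s hs => ((hflux s (hsub hs)).continuousWithinAt).mono hsub) (fun s hs => ?_) hI1
    exact (hflux s (hsub (Ioo_subset_Icc_self hs))).hasDerivAt
      (Icc_mem_nhds hs.1 (hs.2.trans_le ht.2))
  have hle : ∫ s in (0 : ℝ)..t, -(max |u₀| |u₁| * (|K 0 s| * (ρ 0 s + ρ 1 s)))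
      ≤ ∫ s in (0 : ℝ)..t, -(K 0 s * (ρ 1 s * u₁ - ρ 0 s * u₀)) := by
    refine intervalIntegral.integral_mono_on ht.1 (hI2.const_mul _).neg hI1 fun s hs => ?_
    have p0 := hsol.pos 0 h0 s (hsub hs)
    have p1 := hsol.pos 1 h1 s (hsub hs)
    have hb : |ρ 1 s * u₁ - ρ 0 s * u₀| ≤ max |u₀| |u₁| * (ρ 0 s + ρ 1 s) := by
      refine (abs_sub _ _).trans ?_
      rw [abs_mul, abs_mul, abs_of_pos p0, abs_of_pos p1]
      nlinarith [le_max_left |u₀| |u₁|, le_max_right |u₀| |u₁|]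
    have hb' := mul_le_mul_of_nonneg_left hb (abs_nonneg (K 0 s))
    rw [← abs_mul] at hb'
    linarith [le_abs_self (K 0 s * (ρ 1 s * u₁ - ρ 0 s * u₀))]
  rw [hEt, intervalIntegral.integral_neg, intervalIntegral.integral_const_mul] at hle
  linarith
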